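/- arXiv:2410.14639 — 3 statements merged into one kernel-verified Lean document; each statement's English description precedes it below -/
import Mathlib

section
/- Let (S, 𝒜, μ) be a probability space and let f, g : S → ℝ be bounded measurable functions. Let x₁, …, xₙ be i.i.d. samples from μ. Then there exists N such that for all n ≥ N, with probability at least 1 − 2/n⁹, one has |(1/n) Σ_{i=1}^n f(xᵢ)g(xᵢ) − ∫_S f g dμ| ≤ 6 √(log(n)/n) · ‖f‖_{L⁴(μ)} ‖g‖_{L⁴(μ)}. -/
open MeasureTheory

lemma Real.exp_le_one_add_add_sq {x : ℝ} (hx : |x| ≤ 1) : Real.exp x ≤ 1 + x + x ^ 2 := by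
  have := (abs_le.mp (Real.abs_exp_sub_one_sub_id_le hx)).2
  linarith

lemma integrable_of_abs_le {S : Type*} [MeasurableSpace S] {μ : Measure S} [IsFiniteMeasure μ]
    {h : S → ℝ} (hm : Measurable h) {M : ℝ} (hb : ∀ s, |h s| ≤ M) : Integrable h μ :=
  Integrable.of_bound hm.aestronglyMeasurable M (Filter.Eventually.of_forall hb)

/-- The moment generating function of a bounded centred variable is bounded through its
second moment, for small parameters. -/
lemma integral_exp_mul_le {S : Type*} [MeasurableSpace S] (μ : Measure S) [IsProbabilityMeasure μ]
    {h : S → ℝ} (hm : Measurable h) {M v l : ℝ} (hb : ∀ s, |h s| ≤ M) (h0 : ∫ s, h s ∂μ = 0)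
    (hv : ∫ s, h s ^ 2 ∂μ ≤ v) (hl : 0 ≤ l) (hlM : l * M ≤ 1) :
    ∫ s, Real.exp (l * h s) ∂μ ≤ Real.exp (l ^ 2 * v) := by
  have hle : ∀ s, |l * h s| ≤ 1 := fun s => by
    rw [abs_mul, abs_of_nonneg hl]
    exact (mul_le_mul_of_nonneg_left (hb s) hl).trans hlM
  have hi : Integrable h μ := integrable_of_abs_le hm hb
  have hi2 : Integrable (fun s => h s ^ 2) μ :=
    integrable_of_abs_le (hm.pow_const 2) (M := M ^ 2) fun s => by
      rw [abs_pow]; exact pow_le_pow_left₀ (abs_nonneg _) (hb s) 2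
  have hie : Integrable (fun s => Real.exp (l * h s)) μ :=
    integrable_of_abs_le (by fun_prop) (M := Real.exp 1) fun s => by
      rw [Real.abs_exp]; exact Real.exp_le_exp.mpr (abs_le.mp (hle s)).2
  have h1l : Integrable (fun s => 1 + l * h s) μ := (integrable_const 1).add (hi.const_mul l)
  calc ∫ s, Real.exp (l * h s) ∂μ
      ≤ ∫ s, ((1 + l * h s) + l ^ 2 * h s ^ 2) ∂μ := by
        refine integral_mono hie (h1l.add (hi2.const_mul _)) fun s => ?_
        have := Real.exp_le_one_add_add_sq (hle s)
        rwa [mul_pow] at this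
    _ = 1 + l ^ 2 * ∫ s, h s ^ 2 ∂μ := by
        rw [integral_add h1l (hi2.const_mul _), integral_add (integrable_const 1) (hi.const_mul l),
          integral_const_mul, integral_const_mul, h0]
        simp
    _ ≤ 1 + l ^ 2 * v := by gcongr
    _ ≤ Real.exp (l ^ 2 * v) := by linarith [Real.add_one_le_exp (l ^ 2 * v)]

/-- A Chernoff bound for sums of i.i.d. bounded centred variables. -/
lemma measure_pi_sum_ge_le {S : Type*} [MeasurableSpace S] (μ : Measure S) [IsProbabilityMeasure μ]
    {h : S → ℝ} (hm : Measurable h) {M v l : ℝ} (hb : ∀ s, |h s| ≤ M) (h0 : ∫ s, h s ∂μ = 0)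
    (hv : ∫ s, h s ^ 2 ∂μ ≤ v) (hl : 0 ≤ l) (hlM : l * M ≤ 1) (n : ℕ) (ε : ℝ) :
    (Measure.pi (fun _ : Fin n => μ)) {x : Fin n → S | ε ≤ ∑ i, h (x i)} ≤
      ENNReal.ofReal (Real.exp (-l * ε + n * (l ^ 2 * v))) := by
  set P := Measure.pi (fun _ : Fin n => μ)
  have hexp : ∀ x : Fin n → S,
      Real.exp (l * ∑ i, h (x i)) = ∏ i, Real.exp (l * h (x i)) := fun x => by
    rw [Finset.mul_sum, Real.exp_sum]
  have hint : Integrable (fun x : Fin n → S => Real.exp (l * ∑ i, h (x i))) P := by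
    refine integrable_of_abs_le (by fun_prop) (M := Real.exp (l * ∑ _i : Fin n, M)) fun x => ?_
    rw [Real.abs_exp]
    gcongr with i
    exact (abs_le.mp (hb (x i))).2
  rw [← ofReal_measureReal]
  refine ENNReal.ofReal_le_ofReal ?_
  refine (ProbabilityTheory.measure_ge_le_exp_mul_mgf ε hl hint).trans ?_
  rw [Real.exp_add, Real.exp_nat_mul]
  gcongr
  simp only [ProbabilityTheory.mgf, hexp]
  rw [integral_fintype_prod_eq_pow (ι := Fin n) (fun s => Real.exp (l * h s)), Fintype.card_fin]
  exact pow_le_pow_left₀ (integral_nonneg fun _ => (Real.exp_pos _).le)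
    (integral_exp_mul_le μ hm hb h0 hv hl hlM) n

/-- The Cauchy-Schwarz inequality bounding the second moment of a product by `L⁴` norms. -/
lemma integral_mul_sq_le_L4 {S : Type*} [MeasurableSpace S] (μ : Measure S)
    [IsProbabilityMeasure μ] {f g : S → ℝ} (hfm : Measurable f) (hgm : Measurable g)
    {Cf Cg : ℝ} (hfb : ∀ s, |f s| ≤ Cf) (hgb : ∀ s, |g s| ≤ Cg) :
    ∫ s, (f s * g s) ^ 2 ∂μ ≤
      ((∫ s, |f s| ^ 4 ∂μ) ^ ((1 : ℝ) / 4) * (∫ s, |g s| ^ 4 ∂μ) ^ ((1 : ℝ) / 4)) ^ 2 := by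
  have hmem : ∀ {u : S → ℝ} {C : ℝ}, Measurable u → (∀ s, |u s| ≤ C) →
      MemLp (fun s => u s ^ 2) (ENNReal.ofReal 2) μ := fun {u C} hu hC =>
    MemLp.of_bound (by fun_prop) (C ^ 2) (Filter.Eventually.of_forall fun s => by
      rw [Real.norm_eq_abs, abs_pow]; exact pow_le_pow_left₀ (abs_nonneg _) (hC s) 2)
  have hpow : ∀ u : S → ℝ, (∫ s, (u s ^ 2) ^ (2 : ℝ) ∂μ) ^ ((1 : ℝ) / 2) =
      ((∫ s, |u s| ^ 4 ∂μ) ^ ((1 : ℝ) / 4)) ^ 2 := fun u => by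
    rw [← Real.rpow_mul_natCast (integral_nonneg fun s => by positivity)]
    congr 1
    · refine integral_congr_ae (Filter.Eventually.of_forall fun s => ?_)
      have : |u s| ^ 4 = (|u s| ^ 2) ^ 2 := by ring
      simp only [Real.rpow_two, this, sq_abs]
    · norm_num
  have := integral_mul_le_Lp_mul_Lq_of_nonneg (μ := μ) Real.HolderConjugate.two_two
    (Filter.Eventually.of_forall fun s => sq_nonneg (f s))
    (Filter.Eventually.of_forall fun s => sq_nonneg (g s)) (hmem hfm hfb) (hmem hgm hgb)
  rw [hpow, hpow, ← mul_pow] at this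
  simpa only [mul_pow] using this

/-- Concentration of the empirical mean of a bounded variable whose second moment is at most
`K ^ 2`, with failure probability `2 / n ^ 9`. -/
lemma exists_measure_pi_empirical_mean_le {S : Type*} [MeasurableSpace S] (μ : Measure S)
    [IsProbabilityMeasure μ] {X : S → ℝ} (hXm : Measurable X) {C K : ℝ} (hXb : ∀ s, |X s| ≤ C)
    (hK : 0 ≤ K) (hXK : ∫ s, X s ^ 2 ∂μ ≤ K ^ 2) :
    ∃ N : ℕ, ∀ n : ℕ, N ≤ n →
      (Measure.pi (fun _ : Fin n => μ))
        {x : Fin n → S | ¬ |(1 / (n : ℝ)) * ∑ i : Fin n, X (x i) - ∫ s, X s ∂μ| ≤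
              6 * Real.sqrt (Real.log n / n) * K} ≤
        ENNReal.ofReal (2 / (n : ℝ) ^ 9) := by
  have hXi : Integrable X μ := integrable_of_abs_le hXm hXb
  have hXi2 : Integrable (fun s => X s ^ 2) μ :=
    integrable_of_abs_le (hXm.pow_const 2) (M := C ^ 2) fun s => by
      rw [abs_pow]; exact pow_le_pow_left₀ (abs_nonneg _) (hXb s) 2
  set m := ∫ s, X s ∂μ with hm
  rcases hK.eq_or_lt with rfl | hKpos
  · have hX0 : X =ᵐ[μ] 0 := by
      have h0 : ∫ s, X s ^ 2 ∂μ = 0 :=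
        le_antisymm (by simpa using hXK) (integral_nonneg fun s => sq_nonneg _)
      filter_upwards [(integral_eq_zero_iff_of_nonneg (fun s => sq_nonneg (X s)) hXi2).mp h0]
        with s hs
      simpa using hs
    have hm0 : m = 0 := by rw [hm, integral_congr_ae hX0]; simp
    refine ⟨0, fun n _ => ?_⟩
    have hall : ∀ᵐ x ∂(Measure.pi (fun _ : Fin n => μ)), ∀ i, X (x i) = 0 :=
      ae_all_iff.mpr fun i =>
        (measurePreserving_eval (fun _ : Fin n => μ) i).quasiMeasurePreserving.ae hX0
    refine (le_of_eq ?_).trans zero_le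
    refine ae_iff.mp ?_
    filter_upwards [hall] with x hx
    simp [hx, hm0]
  set h : S → ℝ := fun s => X s - m with hh
  have hhm : Measurable h := hXm.sub_const m
  have hhb : ∀ s, |h s| ≤ C + |m| := fun s => (abs_sub _ _).trans (by gcongr; exact hXb s)
  have hh0 : ∫ s, h s ∂μ = 0 := by simp [hh, integral_sub hXi (integrable_const m), ← hm]
  have hhK : ∫ s, h s ^ 2 ∂μ ≤ K ^ 2 := by
    have hv := ProbabilityTheory.variance_le_expectation_sq (μ := μ) hXm.aestronglyMeasurable
    rw [ProbabilityTheory.variance_eq_integral hXm.aemeasurable] at hv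
    exact hv.trans hXK
  have hlim : Filter.Tendsto (fun n : ℕ => 3 * √(Real.log n / n) / K * (C + |m|))
      Filter.atTop (nhds 0) := by
    have h1 : Filter.Tendsto (fun n : ℕ => Real.log n / (n : ℝ)) Filter.atTop (nhds 0) :=
      (Real.isLittleO_log_id_atTop.tendsto_div_nhds_zero).comp tendsto_natCast_atTop_atTop
    simpa using ((h1.sqrt.const_mul 3).div_const K).mul_const (C + |m|)
  obtain ⟨N, hN⟩ := Filter.eventually_atTop.mp (hlim.eventually_le_const zero_lt_one)
  refine ⟨max N 1, fun n hn => ?_⟩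
  have hn0 : (0 : ℝ) < n := by exact_mod_cast (le_max_right N 1).trans hn
  have hn1 : (1 : ℝ) ≤ n := by exact_mod_cast (le_max_right N 1).trans hn
  have hlM := hN n ((le_max_left N 1).trans hn)
  set r := √(Real.log n / n) with hr
  have hr2 : n * r ^ 2 = Real.log n := by
    rw [hr, Real.sq_sqrt (div_nonneg (Real.log_nonneg hn1) hn0.le)]
    field_simp
  have hl : 0 ≤ 3 * r / K := by positivity
  have hexp : Real.exp (-(3 * r / K) * (n * (6 * r * K)) + n * ((3 * r / K) ^ 2 * K ^ 2)) =
      1 / (n : ℝ) ^ 9 := by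
    have : -(3 * r / K) * (n * (6 * r * K)) + n * ((3 * r / K) ^ 2 * K ^ 2) =
        -((9 : ℕ) * Real.log n) := by
      rw [← hr2]; field_simp; push_cast; ring
    rw [this, Real.exp_neg, Real.exp_nat_mul, Real.exp_log hn0, one_div]
  have hpos := measure_pi_sum_ge_le μ hhm hhb hh0 hhK hl hlM n (n * (6 * r * K))
  have hneg := measure_pi_sum_ge_le μ hhm.neg (h := -h) (by simpa using hhb)
    (by simp [integral_neg, hh0]) (by simpa using hhK) hl hlM n (n * (6 * r * K))
  rw [hexp] at hpos hneg
  have hsum : (2 : ℝ) / (n : ℝ) ^ 9 = 1 / (n : ℝ) ^ 9 + 1 / (n : ℝ) ^ 9 := by ring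
  rw [hsum, ENNReal.ofReal_add (by positivity) (by positivity)]
  refine (measure_mono ?_).trans ((measure_union_le _ _).trans (add_le_add hpos hneg))
  intro x hx
  have hmean : ∑ i, h (x i) = n * (1 / (n : ℝ) * ∑ i, X (x i) - m) := by
    simp only [hh, Finset.sum_sub_distrib, Finset.sum_const, Finset.card_univ, Fintype.card_fin,
      nsmul_eq_mul]
    field_simp
  simp only [Set.mem_ofPred_eq, not_le] at hx
  rcases lt_abs.mp hx with hx | hx
  · left
    rw [Set.mem_ofPred_eq, hmean]
    exact mul_le_mul_of_nonneg_left hx.le hn0.le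
  · right
    simp only [Set.mem_ofPred_eq, Pi.neg_apply, Finset.sum_neg_distrib, hmean, ← mul_neg]
    exact mul_le_mul_of_nonneg_left hx.le hn0.le



/-- For bounded measurable `f, g` on a probability space `(S, μ)` and
i.i.d. samples `x₁, …, xₙ` from `μ` (modeled by the product measure on `Fin n → S`),
for all sufficiently large `n`, with probability at least `1 - 2/n⁹`,
`|(1/n) ∑ᵢ f(xᵢ)g(xᵢ) - ∫ f g dμ| ≤ 6 √(log n / n) ‖f‖_{L⁴(μ)} ‖g‖_{L⁴(μ)}`. -/
theorem stmt_0 {S : Type*} [MeasurableSpace S] (μ : Measure S) [IsProbabilityMeasure μ]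
    (f g : S → ℝ) (hfm : Measurable f) (hgm : Measurable g)
    (Cf Cg : ℝ) (hfb : ∀ s, |f s| ≤ Cf) (hgb : ∀ s, |g s| ≤ Cg) :
    ∃ N : ℕ, ∀ n : ℕ, N ≤ n →
      (Measure.pi (fun _ : Fin n => μ))
        {x : Fin n → S |
          ¬ |(1 / (n : ℝ)) * ∑ i : Fin n, f (x i) * g (x i) - ∫ s, f s * g s ∂μ| ≤
              6 * Real.sqrt (Real.log n / n) *
                ((∫ s, |f s| ^ 4 ∂μ) ^ ((1 : ℝ) / 4)) *
                ((∫ s, |g s| ^ 4 ∂μ) ^ ((1 : ℝ) / 4))} ≤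
        ENNReal.ofReal (2 / (n : ℝ) ^ 9) := by
  have hb : ∀ s, |f s * g s| ≤ Cf * Cg := fun s => by
    rw [abs_mul]
    exact mul_le_mul (hfb s) (hgb s) (abs_nonneg _) ((abs_nonneg _).trans (hfb s))
  have hK : 0 ≤ (∫ s, |f s| ^ 4 ∂μ) ^ ((1 : ℝ) / 4) * (∫ s, |g s| ^ 4 ∂μ) ^ ((1 : ℝ) / 4) :=
    mul_nonneg (Real.rpow_nonneg (integral_nonneg fun s => by positivity) _)
      (Real.rpow_nonneg (integral_nonneg fun s => by positivity) _)
  simpa only [mul_assoc] using exists_measure_pi_empirical_mean_le μ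
    (X := fun s => f s * g s) (hfm.mul hgm) hb hK
    (integral_mul_sq_le_L4 μ hfm hgm hfb hgb)
end

section
/- Let (S, 𝒜, μ) be a probability space, let f : S → ℝ be a bounded measurable function, and let x₁, …, xₙ be i.i.d. samples from μ. Then there exists N such that for all n ≥ N, with probability at least 1 − 2/n⁹, one has ‖P_n f‖₂² ≤ ‖f‖²_{L²(μ)} + 6 √(log(n)/n) · ‖f‖²_{L⁴(μ)}, where ‖P_n f‖₂² = (1/n) Σ_{i=1}^n f(xᵢ)². -/
open MeasureTheory

open ProbabilityTheory Filter

/-- The moment generating function of a bounded nonnegative variable is controlled by its first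
two moments, as long as the parameter times the bound is at most one. -/
lemma mgf_le_exp_first_two_moments {S : Type*} [MeasurableSpace S] {μ : Measure S}
    [IsProbabilityMeasure μ] {g : S → ℝ} (hg : Measurable g) (hg0 : ∀ s, 0 ≤ g s) {B : ℝ}
    (hgB : ∀ s, g s ≤ B) {t : ℝ} (ht : 0 ≤ t) (htB : t * B ≤ 1) :
    mgf g μ t ≤ Real.exp (t * (∫ s, g s ∂μ) + t ^ 2 * ∫ s, g s ^ 2 ∂μ) := by
  have hi1 : Integrable g μ :=
    Integrable.of_bound hg.aestronglyMeasurable B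
      (ae_of_all _ fun s => by rw [Real.norm_of_nonneg (hg0 s)]; exact hgB s)
  have hi2 : Integrable (fun s => g s ^ 2) μ :=
    Integrable.of_bound (hg.pow_const 2).aestronglyMeasurable (B ^ 2)
      (ae_of_all _ fun s => by
        rw [Real.norm_of_nonneg (sq_nonneg _)]
        exact pow_le_pow_left₀ (hg0 s) (hgB s) 2)
  have hle : ∀ s, t * g s ≤ 1 := fun s =>
    (mul_le_mul_of_nonneg_left (hgB s) ht).trans htB
  have hi3 : Integrable (fun s => Real.exp (t * g s)) μ :=
    Integrable.of_bound (hg.const_mul t).exp.aestronglyMeasurable (Real.exp 1)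
      (ae_of_all _ fun s => by
        rw [Real.norm_of_nonneg (Real.exp_nonneg _)]
        exact Real.exp_le_exp.2 (hle s))
  have hlin : Integrable (fun s => 1 + t * g s) μ := (integrable_const 1).add (hi1.const_mul t)
  have hmom : ∫ s, (1 + t * g s + t ^ 2 * g s ^ 2) ∂μ
      = 1 + (t * (∫ s, g s ∂μ) + t ^ 2 * ∫ s, g s ^ 2 ∂μ) := by
    rw [integral_add hlin (hi2.const_mul _), integral_add (integrable_const 1) (hi1.const_mul t),
      integral_const_mul, integral_const_mul]
    simp [add_assoc]
  calc mgf g μ t ≤ ∫ s, (1 + t * g s + t ^ 2 * g s ^ 2) ∂μ := by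
        refine integral_mono hi3 (hlin.add (hi2.const_mul _)) fun s => ?_
        have h := Real.abs_exp_sub_one_sub_id_le (x := t * g s)
          (by rw [abs_of_nonneg (mul_nonneg ht (hg0 s))]; exact hle s)
        have := (abs_le.1 h).2
        simp only
        nlinarith
    _ ≤ _ := by
        rw [hmom, add_comm]
        exact Real.add_one_le_exp _

/-- Chernoff bound for sums of i.i.d. copies of a bounded nonnegative variable. -/
lemma pi_measureReal_sum_ge_le {S : Type*} [MeasurableSpace S] {μ : Measure S}
    [IsProbabilityMeasure μ] {g : S → ℝ} (hg : Measurable g) (hg0 : ∀ s, 0 ≤ g s) {B : ℝ}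
    (hgB : ∀ s, g s ≤ B) {t : ℝ} (ht : 0 ≤ t) (htB : t * B ≤ 1) (n : ℕ) (ε : ℝ) :
    (Measure.pi (fun _ : Fin n => μ)).real {x | ε ≤ ∑ i, g (x i)} ≤
      Real.exp (n * (t * (∫ s, g s ∂μ) + t ^ 2 * ∫ s, g s ^ 2 ∂μ) - t * ε) := by
  have hmeas : Measurable fun x : Fin n → S => ∑ i, g (x i) :=
    Finset.measurable_sum _ fun i _ => hg.comp (measurable_pi_apply i)
  have hint : Integrable (fun x : Fin n → S => Real.exp (t * ∑ i, g (x i)))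
      (Measure.pi fun _ : Fin n => μ) := by
    refine Integrable.of_bound (hmeas.const_mul t).exp.aestronglyMeasurable
      (Real.exp (t * (n * B))) (ae_of_all _ fun x => ?_)
    rw [Real.norm_of_nonneg (Real.exp_nonneg _)]
    refine Real.exp_le_exp.2 (mul_le_mul_of_nonneg_left ?_ ht)
    exact (Finset.sum_le_sum fun i _ => hgB (x i)).trans (by simp)
  have hmgf : mgf (fun x : Fin n → S => ∑ i, g (x i)) (Measure.pi fun _ : Fin n => μ) t
      = mgf g μ t ^ n := by
    simp only [mgf, Finset.mul_sum, Real.exp_sum]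
    simpa using integral_fintype_prod_eq_pow (ι := Fin n) (μ := μ)
      (fun s => Real.exp (t * g s))
  refine (measure_ge_le_exp_mul_mgf ε ht hint).trans ?_
  rw [hmgf, sub_eq_neg_add, Real.exp_add, Real.exp_nat_mul, neg_mul]
  gcongr
  · exact mgf_nonneg
  · exact mgf_le_exp_first_two_moments hg hg0 hgB ht htB

/-- For a bounded measurable `f` on a probability space `(S, μ)` and
i.i.d. samples `x₁, …, xₙ` from `μ`, for all sufficiently large `n`, with probability at
least `1 - 2/n⁹`, `‖Pₙ f‖₂² = (1/n) ∑ᵢ f(xᵢ)² ≤ ‖f‖²_{L²(μ)} + 6 √(log n / n) ‖f‖²_{L⁴(μ)}`. -/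
theorem stmt_2 {S : Type*} [MeasurableSpace S] (μ : Measure S) [IsProbabilityMeasure μ]
    (f : S → ℝ) (hfm : Measurable f) (Cf : ℝ) (hfb : ∀ s, |f s| ≤ Cf) :
    ∃ N : ℕ, ∀ n : ℕ, N ≤ n →
      (Measure.pi (fun _ : Fin n => μ))
        {x : Fin n → S |
          ¬ (1 / (n : ℝ)) * ∑ i : Fin n, f (x i) ^ 2 ≤
              (∫ s, |f s| ^ 2 ∂μ) +
                6 * Real.sqrt (Real.log n / n) *
                  ((∫ s, |f s| ^ 4 ∂μ) ^ ((1 : ℝ) / 4)) ^ 2} ≤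
        ENNReal.ofReal (2 / (n : ℝ) ^ 9) := by
  set m : ℝ := ∫ s, |f s| ^ 2 ∂μ with hm
  set v : ℝ := ∫ s, |f s| ^ 4 ∂μ with hv
  have hv0 : 0 ≤ v := integral_nonneg fun s => by positivity
  have hroot : (v ^ ((1 : ℝ) / 4)) ^ 2 = √v := by
    rw [← Real.rpow_natCast, ← Real.rpow_mul hv0, Real.sqrt_eq_rpow]
    norm_num
  simp only [hroot]
  rcases hv0.eq_or_lt with hv_zero | hv_pos
  · have hint : Integrable (fun s => |f s| ^ 4) μ :=
      Integrable.of_bound (hfm.abs.pow_const 4).aestronglyMeasurable (Cf ^ 4)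
        (ae_of_all _ fun s => by
          rw [Real.norm_of_nonneg (by positivity)]
          exact pow_le_pow_left₀ (abs_nonneg _) (hfb s) 4)
    have hf0 : ∀ᵐ s ∂μ, f s = 0 := by
      filter_upwards [(integral_eq_zero_iff_of_nonneg (fun s => by positivity) hint).1
        hv_zero.symm] with s hs
      simpa using hs
    refine ⟨0, fun n _ => le_of_eq_of_le ?_ zero_le⟩
    have hall : ∀ᵐ x ∂(Measure.pi fun _ : Fin n => μ), ∀ i, f (x i) = 0 :=
      ae_all_iff.2 fun i =>
        (Measure.quasiMeasurePreserving_eval (fun _ : Fin n => μ) i).ae hf0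
    refine ae_iff.1 ?_
    filter_upwards [hall] with x hx
    have hm0 : 0 ≤ m := integral_nonneg fun s => by positivity
    simp only [hx]
    simp only [ne_eq, OfNat.ofNat_ne_zero, not_false_eq_true, zero_pow, Finset.sum_const_zero,
      mul_zero]
    positivity
  · have hlim : Tendsto (fun n : ℕ => 3 * √(Real.log n / n) / √v * Cf ^ 2) atTop (nhds 0) := by
      have h1 : Tendsto (fun x : ℝ => Real.log x / x) atTop (nhds 0) :=
        Real.isLittleO_log_id_atTop.tendsto_div_nhds_zero
      have h2 := (h1.comp tendsto_natCast_atTop_atTop).sqrt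
      simpa using ((h2.const_mul 3).div_const (√v)).mul_const (Cf ^ 2)
    obtain ⟨N, hN⟩ := eventually_atTop.1
      ((hlim.eventually_le_const one_pos).and (eventually_ge_atTop 1))
    refine ⟨N, fun n hn => ?_⟩
    obtain ⟨hsmall, hn1⟩ := hN n hn
    have hn0 : (0 : ℝ) < n := by exact_mod_cast hn1
    set σ : ℝ := √(Real.log n / n) with hσ
    have hσ2 : σ ^ 2 = Real.log n / n :=
      Real.sq_sqrt (div_nonneg (Real.log_natCast_nonneg n) hn0.le)
    have key := pi_measureReal_sum_ge_le (μ := μ) (g := fun s => f s ^ 2) (hfm.pow_const 2)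
      (fun s => sq_nonneg _) (B := Cf ^ 2) (fun s => sq_le_sq' (abs_le.1 (hfb s)).1
        (abs_le.1 (hfb s)).2) (t := 3 * σ / √v) (by positivity) hsmall n
      (n * (m + 6 * σ * √v))
    have hm' : ∫ s, f s ^ 2 ∂μ = m := by simp [hm]
    have hv' : ∫ s, (f s ^ 2) ^ 2 ∂μ = v := by
      rw [hv]
      congr 1 with s
      rw [← sq_abs (f s), ← pow_mul]
    have hexp : n * (3 * σ / √v * m + (3 * σ / √v) ^ 2 * v)
        - 3 * σ / √v * (n * (m + 6 * σ * √v)) = -(9 : ℕ) * Real.log n := by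
      have hlog : Real.log n = n * σ ^ 2 := by rw [hσ2]; field_simp
      rw [hlog, div_pow, Real.sq_sqrt hv0]
      push_cast
      field_simp
      ring
    rw [hm', hv', hexp, neg_mul, Real.exp_neg, Real.exp_nat_mul, Real.exp_log hn0] at key
    rw [← ofReal_measureReal]
    refine ENNReal.ofReal_le_ofReal ((measureReal_mono fun x hx => ?_).trans (key.trans ?_))
    · simp only [Set.mem_ofPred_eq, not_le] at hx ⊢
      rw [one_div, inv_mul_eq_div, lt_div_iff₀ hn0] at hx
      linarith
    · rw [div_eq_mul_inv]
      have : 0 < ((n : ℝ) ^ 9)⁻¹ := by positivity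
      linarith
end

section
/- Let φ₁ⁿ, …, φ_κⁿ be unit vectors in ℝⁿ, let ψ₁, …, ψ_κ ∈ ℝⁿ satisfy ‖ψᵢ‖₂ ≤ 2 and ‖φᵢⁿ − ψᵢ‖₂ ≤ β for all i, let λ₁, …, λ_κ and λ₁ⁿ, …, λ_κⁿ be real numbers with |λᵢⁿ − λᵢ| ≤ α for all i, let c₁, …, c_κ be real numbers, let x ∈ ℝⁿ satisfy |⟨x, ψᵢ⟩ − cᵢ| ≤ δ for all i, and let w : ℝ → ℝ be normalized Lipschitz (|w(s) − w(t)| ≤ |s − t|) with |w(t)| ≤ 1 for all t. Then ‖Σ_{i=1}^κ w(λᵢⁿ) ⟨x, φᵢⁿ⟩ φᵢⁿ − Σ_{i=1}^κ w(λᵢ) cᵢ ψᵢ‖₂ ≤ κ(α + 3β) ‖x‖₂ + 2κδ. -/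
open RealInnerProductSpace

/-- Perturbation bound for a single spectral component `a ⟪x, u⟫ u`, with `u` a unit vector,
under changes of the multiplier, the direction and the coefficient. -/
theorem norm_spectral_component_sub_le {E : Type*} [NormedAddCommGroup E] [InnerProductSpace ℝ E]
    {u v x : E} {a b c α β δ r : ℝ} (hu : ‖u‖ = 1) (hv : ‖v‖ ≤ r) (huv : ‖u - v‖ ≤ β)
    (hab : |a - b| ≤ α) (hb : |b| ≤ 1) (hc : |⟪x, v⟫ - c| ≤ δ) :
    ‖(a * ⟪x, u⟫) • u - (b * c) • v‖ ≤ (α + (1 + r) * β) * ‖x‖ + r * δ := by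
  have hα : 0 ≤ α := (abs_nonneg _).trans hab
  have hβ : 0 ≤ β := (norm_nonneg _).trans huv
  have hδ : 0 ≤ δ := (abs_nonneg _).trans hc
  have hxu : |⟪x, u⟫| ≤ ‖x‖ := by
    simpa [hu] using abs_real_inner_le_norm x u
  have hxd : |⟪x, u - v⟫| ≤ ‖x‖ * β :=
    (abs_real_inner_le_norm x (u - v)).trans (by gcongr)
  have key : (a * ⟪x, u⟫) • u - (b * c) • v =
      ((a - b) * ⟪x, u⟫) • u + (b * ⟪x, u⟫) • (u - v) + (b * ⟪x, u - v⟫) • v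
        + (b * (⟪x, v⟫ - c)) • v := by
    rw [inner_sub_right]
    module
  calc ‖(a * ⟪x, u⟫) • u - (b * c) • v‖
      ≤ |a - b| * |⟪x, u⟫| * ‖u‖ + |b| * |⟪x, u⟫| * ‖u - v‖ + |b| * |⟪x, u - v⟫| * ‖v‖
        + |b| * |⟪x, v⟫ - c| * ‖v‖ := by
        rw [key]
        refine norm_add₄_le.trans_eq ?_
        simp only [norm_smul, Real.norm_eq_abs, abs_mul]
    _ ≤ α * ‖x‖ * 1 + 1 * ‖x‖ * β + 1 * (‖x‖ * β) * r + 1 * δ * r := by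
        gcongr
        exact hu.le
    _ = (α + (1 + r) * β) * ‖x‖ + r * δ := by ring

/-- Deterministic core of the spectral filter convergence theorem:
if the `φᵢⁿ` are unit vectors, `‖ψᵢ‖₂ ≤ 2`, `‖φᵢⁿ - ψᵢ‖₂ ≤ β`, `|λᵢⁿ - λᵢ| ≤ α`,
`|⟨x, ψᵢ⟩ - cᵢ| ≤ δ`, and `w` is normalized Lipschitz with `|w| ≤ 1`, then
`‖∑ᵢ w(λᵢⁿ) ⟨x, φᵢⁿ⟩ φᵢⁿ - ∑ᵢ w(λᵢ) cᵢ ψᵢ‖₂ ≤ κ(α + 3β)‖x‖₂ + 2κδ`. -/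
theorem stmt_10 (n κ : ℕ) (φ : Fin κ → EuclideanSpace ℝ (Fin n)) (hφ : ∀ i, ‖φ i‖ = 1)
    (ψ : Fin κ → EuclideanSpace ℝ (Fin n)) (hψ : ∀ i, ‖ψ i‖ ≤ 2)
    (β : ℝ) (hβ : ∀ i, ‖φ i - ψ i‖ ≤ β)
    (lam lamn : Fin κ → ℝ) (α : ℝ) (hα : ∀ i, |lamn i - lam i| ≤ α)
    (c : Fin κ → ℝ) (x : EuclideanSpace ℝ (Fin n)) (δ : ℝ)
    (hδ : ∀ i, |⟪x, ψ i⟫ - c i| ≤ δ)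
    (w : ℝ → ℝ) (hwlip : ∀ s t : ℝ, |w s - w t| ≤ |s - t|) (hw1 : ∀ t, |w t| ≤ 1) :
    ‖(∑ i, (w (lamn i) * ⟪x, φ i⟫) • φ i) - ∑ i, (w (lam i) * c i) • ψ i‖ ≤
      κ * (α + 3 * β) * ‖x‖ + 2 * κ * δ := by
  rw [← Finset.sum_sub_distrib]
  calc _ ≤ ∑ _i : Fin κ, ((α + (1 + 2) * β) * ‖x‖ + 2 * δ) :=
        norm_sum_le_of_le _ fun i _ => norm_spectral_component_sub_le (hφ i) (hψ i) (hβ i)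
          ((hwlip _ _).trans (hα i)) (hw1 _) (hδ i)
    _ = κ * (α + 3 * β) * ‖x‖ + 2 * κ * δ := by
        rw [Finset.sum_const, Finset.card_univ, Fintype.card_fin, nsmul_eq_mul]
        ring
end
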